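/- (Multi-secant DFP update.) Let M be a symmetric positive definite d×d matrix, J₀ a symmetric d×d matrix, and let A = YC and B = RC be d×(N−1) matrices with A of full column rank and AᵀB = BᵀA (so a symmetric solution of the secant system exists). Define A⁺ = (AᵀM⁻¹A)⁻¹AᵀM⁻¹ and P = AA⁺. Then the matrix J* = BA⁺ + (BA⁺)ᵀ(I − P) + (I − P)ᵀJ₀(I − P) is symmetric, satisfies J*A = B, and is the unique minimizer of J ↦ ‖J − J₀‖_M² over the set {J ∈ ℝ^{d×d} : JA = B, J = Jᵀ}. -/

import Mathlib

open Matrix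

/-- Squared weighted Frobenius norm `‖X‖_M² = Tr(M Xᵀ M X)`. -/
noncomputable def frobSq {d : ℕ} (M X : Matrix (Fin d) (Fin d) ℝ) : ℝ :=
  Matrix.trace (M * Xᵀ * M * X)

open scoped MatrixOrder Matrix.Norms.L2Operator in
theorem Matrix.PosDef.exists_isUnit_eq_conjTranspose_mul_self {n : Type*} [Fintype n]
    [DecidableEq n] {M : Matrix n n ℝ} (hM : M.PosDef) : ∃ L, IsUnit L ∧ M = Lᴴ * L :=
  CStarAlgebra.isStrictlyPositive_iff_eq_star_mul_self.mp hM.isStrictlyPositive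

/-- The weighted Frobenius norm is an ordinary Frobenius norm after a congruence. -/
theorem frobSq_eq_trace_conjTranspose_mul_self {d : ℕ} (L X : Matrix (Fin d) (Fin d) ℝ) :
    frobSq (Lᴴ * L) X = ((L * X * Lᴴ)ᴴ * (L * X * Lᴴ)).trace := by
  have h : (L * X * Lᴴ)ᴴ * (L * X * Lᴴ) = (L * Xᵀ * (Lᴴ * L) * X) * Lᴴ := by
    simp [conjTranspose_eq_transpose_of_trivial, Matrix.mul_assoc]
  rw [h, Matrix.trace_mul_comm, frobSq]
  simp only [Matrix.mul_assoc]

theorem frobSq_nonneg {d : ℕ} {M : Matrix (Fin d) (Fin d) ℝ} (hM : M.PosDef)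
    (X : Matrix (Fin d) (Fin d) ℝ) : 0 ≤ frobSq M X := by
  obtain ⟨L, -, rfl⟩ := hM.exists_isUnit_eq_conjTranspose_mul_self
  rw [frobSq_eq_trace_conjTranspose_mul_self]
  exact (posSemidef_conjTranspose_mul_self _).trace_nonneg

theorem eq_zero_of_frobSq_eq_zero {d : ℕ} {M : Matrix (Fin d) (Fin d) ℝ} (hM : M.PosDef)
    {X : Matrix (Fin d) (Fin d) ℝ} (hX : frobSq M X = 0) : X = 0 := by
  obtain ⟨L, hL, rfl⟩ := hM.exists_isUnit_eq_conjTranspose_mul_self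
  rw [frobSq_eq_trace_conjTranspose_mul_self, trace_conjTranspose_mul_self_eq_zero_iff] at hX
  have hL' : IsUnit Lᴴ := by rwa [← star_eq_conjTranspose, isUnit_star]
  rwa [hL'.mul_left_eq_zero, hL.mul_right_eq_zero] at hX

theorem frobSq_add_of_trace_eq_zero {d : ℕ} {M : Matrix (Fin d) (Fin d) ℝ}
    (hM : M.IsSymm) {D E : Matrix (Fin d) (Fin d) ℝ} (h : (M * Eᵀ * M * D).trace = 0) :
    frobSq M (D + E) = frobSq M D + frobSq M E := by
  have h' : (M * Dᵀ * M * E).trace = 0 := by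
    rw [← Matrix.trace_transpose]
    simp only [Matrix.transpose_mul, Matrix.transpose_transpose, hM.eq]
    rw [← h, ← Matrix.mul_assoc, ← Matrix.mul_assoc, Matrix.trace_mul_comm]
    simp only [Matrix.mul_assoc]
  simp only [frobSq, Matrix.transpose_add, Matrix.mul_add, Matrix.add_mul, Matrix.trace_add]
  linarith

/-- multi-secant DFP update: with `M` symmetric positive definite, `J₀`
symmetric, `A = YC` of full column rank, `B = RC`, `AᵀB = BᵀA`,
`A⁺ = (AᵀM⁻¹A)⁻¹AᵀM⁻¹` and `P = AA⁺`, the matrix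
`J* = BA⁺ + (BA⁺)ᵀ(I − P) + (I − P)ᵀJ₀(I − P)` is symmetric, satisfies `J*A = B`, and
is the unique minimizer of `J ↦ ‖J − J₀‖_M²` over `{J : JA = B, J = Jᵀ}`. -/
theorem stmt14 {d N : ℕ}
    (M : Matrix (Fin d) (Fin d) ℝ) (hM : M.PosDef)
    (J₀ : Matrix (Fin d) (Fin d) ℝ) (hJ₀ : J₀.IsSymm)
    (Y R : Matrix (Fin d) (Fin N) ℝ)
    (C : Matrix (Fin N) (Fin (N - 1)) ℝ)
    (hCrank : Function.Injective C.mulVec)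
    (hC1 : Cᵀ *ᵥ (fun _ => (1:ℝ)) = 0)
    (A B : Matrix (Fin d) (Fin (N - 1)) ℝ) (hA : A = Y * C) (hB : B = R * C)
    (hArank : Function.Injective A.mulVec)
    (hsymm : Aᵀ * B = Bᵀ * A)
    (Aplus : Matrix (Fin (N - 1)) (Fin d) ℝ)
    (hAplus : Aplus = (Aᵀ * M⁻¹ * A)⁻¹ * (Aᵀ * M⁻¹))
    (P : Matrix (Fin d) (Fin d) ℝ) (hP : P = A * Aplus)
    (Jstar : Matrix (Fin d) (Fin d) ℝ)
    (hJstar : Jstar = B * Aplus + (B * Aplus)ᵀ * (1 - P) + (1 - P)ᵀ * J₀ * (1 - P)) :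
    Jstar.IsSymm ∧ Jstar * A = B ∧
    (∀ J : Matrix (Fin d) (Fin d) ℝ, J * A = B → J.IsSymm →
      frobSq M (Jstar - J₀) ≤ frobSq M (J - J₀)) ∧
    (∀ J : Matrix (Fin d) (Fin d) ℝ, J * A = B → J.IsSymm →
      frobSq M (J - J₀) = frobSq M (Jstar - J₀) → J = Jstar) := by
  have hMs : M.IsSymm := by
    simpa [IsSymm, conjTranspose_eq_transpose_of_trivial] using hM.isHermitian.eq
  have hS : (Aᵀ * M⁻¹ * A).PosDef := by
    simpa [conjTranspose_eq_transpose_of_trivial] using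
      hM.inv.conjTranspose_mul_mul_same (B := A) hArank
  have hAA : Aplus * A = 1 := by
    rw [hAplus, Matrix.mul_assoc]
    exact Matrix.nonsing_inv_mul _ ((Matrix.isUnit_iff_isUnit_det _).mp hS.isUnit)
  have hAM : Aplus * M = (Aᵀ * M⁻¹ * A)⁻¹ * Aᵀ := by
    rw [hAplus, Matrix.mul_assoc _ _ M, Matrix.mul_assoc _ _ M,
      Matrix.nonsing_inv_mul _ ((Matrix.isUnit_iff_isUnit_det _).mp hM.isUnit), Matrix.mul_one]
  have hPA : (1 - P) * A = 0 := by
    rw [hP, Matrix.sub_mul, Matrix.mul_assoc, hAA, Matrix.mul_one, Matrix.one_mul, sub_self]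
  have hsym : Jstar.IsSymm := by
    have h : Aplusᵀ * (Aᵀ * (B * Aplus)) = Aplusᵀ * (Bᵀ * (A * Aplus)) := by
      rw [← Matrix.mul_assoc Aᵀ, hsymm, Matrix.mul_assoc]
    rw [IsSymm, hJstar, hP]
    simp only [transpose_add, transpose_sub, transpose_mul, transpose_transpose, transpose_one,
      hJ₀.eq, Matrix.mul_sub, Matrix.sub_mul, Matrix.mul_one, Matrix.one_mul, Matrix.mul_assoc, h]
    abel
  have hsec : Jstar * A = B := by
    rw [hJstar, Matrix.add_mul, Matrix.add_mul, Matrix.mul_assoc _ (1 - P),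
      Matrix.mul_assoc _ (1 - P), hPA, Matrix.mul_assoc, hAA]
    simp
  have hD : Jstar - J₀ = (B - J₀ * A) * Aplus + Aplusᵀ * ((Bᵀ - Aᵀ * J₀) * (1 - P)) := by
    rw [hJstar, hP]
    simp only [transpose_sub, transpose_mul, transpose_one, Matrix.mul_sub, Matrix.sub_mul,
      Matrix.mul_one, Matrix.one_mul, Matrix.mul_assoc]
    abel
  have hpyth : ∀ J : Matrix (Fin d) (Fin d) ℝ, J * A = B → J.IsSymm →
      frobSq M (J - J₀) = frobSq M (Jstar - J₀) + frobSq M (J - Jstar) := by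
    intro J hJ hJs
    have hE : (J - Jstar)ᵀ = J - Jstar := by rw [transpose_sub, hJs.eq, hsym.eq]
    have hEA : (J - Jstar) * A = 0 := by rw [Matrix.sub_mul, hJ, hsec, sub_self]
    have hl : Aplus * M * (J - Jstar) = 0 := by
      have h : Aᵀ * (J - Jstar) = 0 := by
        rw [← hE, ← transpose_mul, hEA, transpose_zero]
      rw [hAM, Matrix.mul_assoc, h, Matrix.mul_zero]
    have hr : (J - Jstar) * M * Aplusᵀ = 0 := by
      simpa [hE, hMs.eq, Matrix.mul_assoc, -transpose_sub] using congrArg transpose hl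
    rw [← frobSq_add_of_trace_eq_zero hMs
      (h := ?_), sub_add_sub_cancel']
    rw [hE, hD, Matrix.mul_add, Matrix.trace_add, ← Matrix.mul_assoc, Matrix.trace_mul_comm]
    have h₁ : Aplus * (M * (J - Jstar) * M * (B - J₀ * A)) = 0 := by
      simp only [← Matrix.mul_assoc, hl, Matrix.zero_mul]
    have h₂ : M * (J - Jstar) * M * (Aplusᵀ * ((Bᵀ - Aᵀ * J₀) * (1 - P))) = 0 := by
      rw [← Matrix.mul_assoc, Matrix.mul_assoc M, Matrix.mul_assoc M, hr, Matrix.mul_zero,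
        Matrix.zero_mul]
    rw [h₁, h₂, Matrix.trace_zero, Matrix.trace_zero, add_zero]
  refine ⟨hsym, hsec, fun J hJ hJs => ?_, fun J hJ hJs h => ?_⟩
  · rw [hpyth J hJ hJs]
    exact le_add_of_nonneg_right (frobSq_nonneg hM _)
  · rw [hpyth J hJ hJs, add_eq_left] at h
    exact sub_eq_zero.mp (eq_zero_of_frobSq_eq_zero hM h)
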